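/- Let τ > 0, α ∈ ℂ, m ≤ q and n ≤ p nonnegative integers, a ∈ ℂ^p, b ∈ ℂ^q with λ♯ < λ♭, and suppose that either N > 0, or N = 0 and Re(α) > 0. Then for every w ∈ ℂ: K^{m,n}_{p,q}(a; b | e^{2πw}; τ, α) = K^{n,m}_{q,p}(1+τ−b; 1+τ−a | e^{−2πw}; τ, α), where 1+τ−b := (1+τ−b_1,…,1+τ−b_q) is the first parameter vector (of length q) and 1+τ−a := (1+τ−a_1,…,1+τ−a_p) is the second parameter vector (of length p) of the K-function on the right-hand side, whose contour constant is any c′ ∈ (−λ♭, −λ♯) while on the left-hand side it is any c ∈ (λ♯, λ♭). -/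

import Mathlib

open Complex Filter MeasureTheory Set

noncomputable section

/-- The digamma function ψ = Γ'/Γ. -/
def digammaC (z : ℂ) : ℂ := deriv Complex.Gamma z / Complex.Gamma z

/-- The gamma modular form C(τ). -/
def gammaModC (τ : ℂ) : ℂ :=
  limUnder atTop fun M : ℕ =>
    (∑ k ∈ Finset.Ico 1 M, digammaC (k * τ)) + digammaC (M * τ) / 2
      - (1 / τ) * Complex.log (Complex.Gamma (M * τ) / (Real.sqrt (2 * Real.pi) : ℂ))

/-- The gamma modular form D(τ). -/
def gammaModD (τ : ℂ) : ℂ :=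
  limUnder atTop fun M : ℕ =>
    (∑ k ∈ Finset.Ico 1 M, deriv digammaC (k * τ)) + deriv digammaC (M * τ) / 2
      - (1 / τ) * digammaC (M * τ)

def aBarnes (τ : ℂ) : ℂ :=
  -(Real.eulerMascheroniConstant : ℂ) * τ + (τ / 2) * Complex.log (2 * Real.pi * τ)
    + (1 / 2) * Complex.log τ - τ * gammaModC τ

def bBarnes (τ : ℂ) : ℂ :=
  -(Real.pi : ℂ) ^ 2 * τ ^ 2 / 6 - τ * Complex.log τ - τ ^ 2 * gammaModD τ

/-- The Barnes double gamma function `G(z;τ)`, via its Weierstrass product. -/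
def barnesG (z τ : ℂ) : ℂ :=
  z / τ * Complex.exp (aBarnes τ * z / τ + bBarnes τ * z ^ 2 / (2 * τ)) *
    ∏' mn : ℕ × ℕ,
      if mn = (0, 0) then 1
      else (1 + z / (mn.1 * τ + mn.2)) *
        Complex.exp (-(z / (mn.1 * τ + mn.2)) + z ^ 2 / (2 * ((mn.1 : ℂ) * τ + (mn.2 : ℂ)) ^ 2))

/-- The ratio of Barnes double gamma functions `𝒢^{m,n}_{p,q}(a;b | s;τ)`. -/
def calG (m n : ℕ) {p q : ℕ} (a : Fin p → ℂ) (b : Fin q → ℂ) (s τ : ℂ) : ℂ :=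
  ((∏ j : Fin q, if (j : ℕ) < m then barnesG (b j - s) τ else 1) *
      ∏ j : Fin p, if (j : ℕ) < n then barnesG (1 + τ - a j + s) τ else 1) /
    ((∏ j : Fin q, if m ≤ (j : ℕ) then barnesG (1 + τ - b j + s) τ else 1) *
      ∏ j : Fin p, if n ≤ (j : ℕ) then barnesG (a j - s) τ else 1)

/-- `N = 2(m+n) - p - q`. -/
def paramN (m n p q : ℕ) : ℤ := 2 * (m + n) - p - q

/-- `ν = Σ a_j - Σ b_j`. -/
def paramNu {p q : ℕ} (a : Fin p → ℂ) (b : Fin q → ℂ) : ℂ := (∑ j, a j) - ∑ j, b j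

/-- `μ = Σ_{j≤n} a_j - Σ_{j>n} a_j + Σ_{j≤m} b_j - Σ_{j>m} b_j`. -/
def paramMu (m n : ℕ) {p q : ℕ} (a : Fin p → ℂ) (b : Fin q → ℂ) : ℂ :=
  (∑ j : Fin p, if (j : ℕ) < n then a j else 0) - (∑ j : Fin p, if n ≤ (j : ℕ) then a j else 0)
    + (∑ j : Fin q, if (j : ℕ) < m then b j else 0) - ∑ j : Fin q, if m ≤ (j : ℕ) then b j else 0

/-- `ξ = Σ_{j≤n} a_j² - Σ_{j>n} a_j² + Σ_{j≤m} b_j² - Σ_{j>m} b_j²`. -/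
def paramXi (m n : ℕ) {p q : ℕ} (a : Fin p → ℂ) (b : Fin q → ℂ) : ℂ :=
  (∑ j : Fin p, if (j : ℕ) < n then a j ^ 2 else 0)
    - (∑ j : Fin p, if n ≤ (j : ℕ) then a j ^ 2 else 0)
    + (∑ j : Fin q, if (j : ℕ) < m then b j ^ 2 else 0)
    - ∑ j : Fin q, if m ≤ (j : ℕ) then b j ^ 2 else 0

/-- The Meijer–Barnes `K`-function with vertical contour `c + iℝ`, at `z = e^{2πw}`:
`K^{m,n}_{p,q}(a;b | e^{2πw}; τ, α) = (1/(2πi)) ∫_{c+iℝ} 𝒢(s) e^{(πα/τ)s²} e^{-2πws} ds`. -/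
def Kfun (m n : ℕ) {p q : ℕ} (a : Fin p → ℂ) (b : Fin q → ℂ) (τ α : ℂ) (c : ℝ) (w : ℂ) : ℂ :=
  1 / (2 * Real.pi * Complex.I) *
    ∫ t : ℝ, (calG m n a b (c + t * Complex.I) τ *
      Complex.exp ((Real.pi : ℂ) * α / τ * (c + t * Complex.I) ^ 2) *
      Complex.exp (-(2 * Real.pi * w * (c + t * Complex.I)))) * Complex.I

/-! ### Lattice sums -/

/-- The lattice point `mτ + n` attached to the pair `(m, n)`. -/
def latticePt (τ : ℝ) (k : ℕ × ℕ) : ℝ := k.1 * τ + k.2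

lemma latticePt_nonneg {τ : ℝ} (hτ : 0 < τ) (k : ℕ × ℕ) : 0 ≤ latticePt τ k := by
  unfold latticePt; positivity

lemma latticePt_pos {τ : ℝ} (hτ : 0 < τ) {k : ℕ × ℕ} (hk : k ≠ 0) : 0 < latticePt τ k := by
  obtain ⟨x, y⟩ := k
  unfold latticePt
  rcases Nat.eq_zero_or_pos x with rfl | hx
  · rcases Nat.eq_zero_or_pos y with rfl | hy
    · exact absurd rfl hk
    · have : (0 : ℝ) < y := by exact_mod_cast hy
      simpa using this
  · have : (0 : ℝ) < x := by exact_mod_cast hx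
    positivity

lemma latticePt_zero (τ : ℝ) : latticePt τ 0 = 0 := by simp [latticePt]

lemma le_latticePt {τ : ℝ} (hτ : 0 < τ) {k : ℕ × ℕ} (hk : k ≠ 0) :
    min τ 1 / 3 * (((k.1 : ℝ) + 1) ^ (1 / 2 : ℝ) * ((k.2 : ℝ) + 1) ^ (1 / 2 : ℝ))
      ≤ latticePt τ k := by
  obtain ⟨x, y⟩ := k
  have hκ : 0 < min τ 1 := lt_min hτ one_pos
  have h1 : (1 : ℝ) ≤ x + y := by
    have : x + y ≠ 0 := by
      intro h
      apply hk
      ext <;> simp <;> omega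
    exact_mod_cast Nat.one_le_iff_ne_zero.mpr this
  have hx : ((x : ℝ) + 1) ^ (1 / 2 : ℝ) * ((y : ℝ) + 1) ^ (1 / 2 : ℝ) ≤ x + 1 + (y + 1) := by
    rw [← Real.mul_rpow (by positivity) (by positivity), ← Real.sqrt_eq_rpow]
    apply Real.sqrt_le_iff.mpr
    constructor
    · positivity
    · nlinarith [sq_nonneg ((x : ℝ) + 1), sq_nonneg ((y : ℝ) + 1),
        mul_nonneg (Nat.cast_nonneg (α := ℝ) x) (Nat.cast_nonneg (α := ℝ) y),
        Nat.cast_nonneg (α := ℝ) x, Nat.cast_nonneg (α := ℝ) y]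
  have h2 : min τ 1 * (x + y : ℝ) ≤ x * τ + y := by
    have h3 : min τ 1 * (x : ℝ) ≤ x * τ := by
      rw [mul_comm]; gcongr; exact min_le_left _ _
    have h4 : min τ 1 * (y : ℝ) ≤ y :=
      mul_le_of_le_one_left (by positivity) (min_le_right _ _)
    linarith
  calc _ ≤ min τ 1 / 3 * (x + 1 + (y + 1)) := by simp only; gcongr
    _ ≤ min τ 1 * (x + y : ℝ) := by nlinarith
    _ ≤ _ := h2

lemma summable_latticePt_rpow {τ : ℝ} (hτ : 0 < τ) {r : ℝ} (hr : 2 < r) :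
    Summable fun k => latticePt τ k ^ (-r) := by
  have hs : Summable fun x : ℕ => ((x : ℝ) + 1) ^ (-(r / 2)) := by
    have := (summable_nat_add_iff 1).mpr
      (Real.summable_nat_rpow (p := -(r / 2)) |>.mpr (by linarith))
    simpa using this
  have hp := (hs.mul_of_nonneg hs (fun _ => by positivity) (fun _ => by positivity)).mul_left
    ((min τ 1 / 3) ^ (-r))
  have hκ : 0 < min τ 1 := lt_min hτ one_pos
  refine Summable.of_nonneg_of_le (fun k => Real.rpow_nonneg (latticePt_nonneg hτ k) _)
    (fun k => ?_) hp
  rcases eq_or_ne k 0 with rfl | hk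
  · rw [latticePt_zero, Real.zero_rpow (by linarith)]
    positivity
  · refine (Real.rpow_le_rpow_of_nonpos (by positivity) (le_latticePt hτ hk)
      (by linarith)).trans_eq ?_
    rw [Real.mul_rpow (by positivity) (by positivity),
      Real.mul_rpow (by positivity) (by positivity),
      ← Real.rpow_mul (by positivity), ← Real.rpow_mul (by positivity)]
    ring_nf

lemma not_summable_latticePt_sq {τ : ℝ} (hτ : 0 < τ) :
    ¬ Summable fun k => 1 / latticePt τ k ^ 2 := by
  intro h
  refine Real.not_summable_one_div_natCast ?_
  have h1 := h.prod.mul_left ((τ + 1) ^ 2)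
  refine Summable.of_nonneg_of_le (fun _ => by positivity) (fun x => ?_) h1
  rcases Nat.eq_zero_or_pos x with rfl | hx
  · simpa using mul_nonneg (sq_nonneg _) (tsum_nonneg fun y => by positivity)
  have hx' : (0 : ℝ) < x := by exact_mod_cast hx
  have h2 : ∑ y ∈ Finset.range x, 1 / latticePt τ (x, y) ^ 2 ≤
      ∑' y, 1 / latticePt τ (x, y) ^ 2 :=
    (h.prod_factor x).sum_le_tsum _ fun _ _ => by positivity
  have h3 : ∑ y ∈ Finset.range x, 1 / ((τ + 1) * x) ^ 2 ≤
      ∑ y ∈ Finset.range x, 1 / latticePt τ (x, y) ^ 2 := by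
    refine Finset.sum_le_sum fun y hy => ?_
    have hy' : (y : ℝ) ≤ x := by exact_mod_cast (Finset.mem_range.mp hy).le
    have hpos : 0 < latticePt τ (x, y) := latticePt_pos hτ (by simp; omega)
    refine one_div_le_one_div_of_le (by positivity) ?_
    refine pow_le_pow_left₀ hpos.le ?_ 2
    simp only [latticePt]
    nlinarith
  calc 1 / (x : ℝ) = (τ + 1) ^ 2 * ∑ y ∈ Finset.range x, 1 / ((τ + 1) * x) ^ 2 := by
        simp; field_simp
    _ ≤ _ := by gcongr; exact h3.trans h2

/-! ### The elementary factor of genus two -/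

/-- The Weierstrass elementary factor of genus two, with its zero at `-1`. -/
def elemFactor (u : ℂ) : ℂ := (1 + u) * Complex.exp (-u + u ^ 2 / 2)

lemma hasDerivAt_elemFactor (u : ℂ) :
    HasDerivAt elemFactor (u ^ 2 * Complex.exp (-u + u ^ 2 / 2)) u := by
  have h := ((hasDerivAt_id u).const_add 1).mul
    (((hasDerivAt_id u).neg.add (((hasDerivAt_id u).pow 2).div_const 2)).cexp)
  refine h.congr_deriv ?_
  simp
  ring

lemma differentiable_elemFactor : Differentiable ℂ elemFactor :=
  fun u => (hasDerivAt_elemFactor u).differentiableAt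

lemma elemFactor_ne_zero {u : ℂ} (hu : 1 + u ≠ 0) : elemFactor u ≠ 0 :=
  mul_ne_zero hu (Complex.exp_ne_zero _)

lemma norm_elemFactor_sub_one_le (u : ℂ) :
    ‖elemFactor u - 1‖ ≤ Real.exp (‖u‖ + ‖u‖ ^ 2) * ‖u‖ ^ 3 := by
  have h := (convex_closedBall (0 : ℂ) ‖u‖).norm_image_sub_le_of_norm_hasDerivWithin_le
    (f := elemFactor) (C := ‖u‖ ^ 2 * Real.exp (‖u‖ + ‖u‖ ^ 2))
    (fun v _ => (hasDerivAt_elemFactor v).hasDerivWithinAt)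
    (fun v hv => ?_) (x := 0) (y := u) (by simp) (by simp)
  · have h0 : elemFactor 0 = 1 := by simp [elemFactor]
    rw [h0, sub_zero] at h
    refine h.trans_eq (by ring)
  · have hv' : ‖v‖ ≤ ‖u‖ := by simpa using hv
    rw [norm_mul, norm_pow, Complex.norm_exp]
    gcongr
    refine (Complex.re_le_norm _).trans ((norm_add_le _ _).trans ?_)
    rw [norm_neg, norm_div, norm_pow]
    have : ‖v‖ ^ 2 ≤ ‖u‖ ^ 2 := by gcongr
    simp
    nlinarith [sq_nonneg ‖v‖]

lemma norm_elemFactor_mul_I_sq (y : ℝ) :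
    ‖elemFactor (y * I)‖ ^ 2 = (1 + y ^ 2) * Real.exp (-y ^ 2) := by
  have h1 : ‖(1 + y * I : ℂ)‖ ^ 2 = 1 + y ^ 2 := by
    rw [← Complex.normSq_eq_norm_sq]
    simp [Complex.normSq_apply]; ring
  have h2 : (-(y * I) + (y * I) ^ 2 / 2 : ℂ).re = -(y ^ 2 / 2) := by
    rw [mul_pow, I_sq]
    have : (-(y * I) + (y : ℂ) ^ 2 * -1 / 2) = ((-(y ^ 2 / 2) : ℝ) : ℂ) + ((-y : ℝ) : ℂ) * I := by
      push_cast; ring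
    rw [this]
    simp only [add_re, ofReal_re, re_ofReal_mul, I_re, mul_zero, add_zero]
  rw [elemFactor, norm_mul, mul_pow, h1, Complex.norm_exp, h2, ← Real.exp_nat_mul]
  congr 2
  push_cast
  ring

lemma norm_elemFactor_neg_mul_I (y : ℝ) :
    ‖elemFactor (-(y * I))‖ = ‖elemFactor (y * I)‖ := by
  refine (pow_left_inj₀ (norm_nonneg _) (norm_nonneg _) two_ne_zero).mp ?_
  have := norm_elemFactor_mul_I_sq (-y)
  push_cast at this
  rw [← neg_mul, this, norm_elemFactor_mul_I_sq]
  simp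

lemma norm_elemFactor_mul_I_le_one (y : ℝ) : ‖elemFactor (y * I)‖ ≤ 1 := by
  refine (sq_le_one_iff₀ (norm_nonneg _)).mp ?_
  rw [norm_elemFactor_mul_I_sq]
  calc _ ≤ Real.exp (y ^ 2) * Real.exp (-y ^ 2) := by
        gcongr; linarith [Real.add_one_le_exp (y ^ 2)]
    _ = 1 := by rw [← Real.exp_add]; simp

lemma norm_elemFactor_mul_I_le {y : ℝ} (hy : 1 ≤ y ^ 2) :
    ‖elemFactor (y * I)‖ ≤ Real.exp (-(y ^ 2 / 8)) := by
  refine (pow_le_pow_iff_left₀ (norm_nonneg _) (Real.exp_nonneg _) two_ne_zero).mp ?_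
  rw [norm_elemFactor_mul_I_sq, ← Real.exp_nat_mul]
  calc (1 + y ^ 2) * Real.exp (-y ^ 2)
      ≤ Real.exp (3 / 4 * y ^ 2) * Real.exp (-y ^ 2) := by
        gcongr
        have := Real.quadratic_le_exp_of_nonneg (x := 3 / 4 * y ^ 2) (by positivity)
        nlinarith
    _ = _ := by rw [← Real.exp_add]; congr 1; push_cast; ring

/-! ### The canonical product -/

/-- The canonical product with zeros at the points `-(mτ + n)`, `(m, n) ≠ (0, 0)`; the factor at
`(0, 0)` is `1`. -/
def latticeProd (τ : ℝ) (z : ℂ) : ℂ := ∏' k, elemFactor (z / latticePt τ k)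

lemma norm_elemFactor_div_latticePt_sub_one_le {τ : ℝ} (hτ : 0 < τ) {R : ℝ} {z : ℂ}
    (hz : ‖z‖ ≤ R) (k : ℕ × ℕ) :
    ‖elemFactor (z / latticePt τ k) - 1‖ ≤
      Real.exp (R / (min τ 1 / 3) + (R / (min τ 1 / 3)) ^ 2) * R ^ 3 *
        latticePt τ k ^ (-3 : ℝ) := by
  have hR : 0 ≤ R := (norm_nonneg _).trans hz
  rcases eq_or_ne k 0 with rfl | hk
  · simp [latticePt_zero, elemFactor]
  have hκ : 0 < min τ 1 / 3 := by have := lt_min hτ one_pos; positivity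
  have hl := latticePt_pos hτ hk
  have hκl : min τ 1 / 3 ≤ latticePt τ k := by
    refine le_trans ?_ (le_latticePt hτ hk)
    refine le_mul_of_one_le_right hκ.le (one_le_mul_of_one_le_of_one_le ?_ ?_) <;>
    exact Real.one_le_rpow (by simp) (by norm_num)
  have hn : ‖z / latticePt τ k‖ = ‖z‖ / latticePt τ k := by
    rw [norm_div, Complex.norm_real, Real.norm_of_nonneg hl.le]
  refine (norm_elemFactor_sub_one_le _).trans ?_
  rw [hn, Real.rpow_neg hl.le, mul_assoc,
    show R ^ 3 * (latticePt τ k ^ (3 : ℝ))⁻¹ = (R / latticePt τ k) ^ 3 by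
      rw [div_pow, div_eq_mul_inv]; norm_cast]
  gcongr

lemma summable_norm_elemFactor_sub_one {τ : ℝ} (hτ : 0 < τ) (z : ℂ) :
    Summable fun k => ‖elemFactor (z / latticePt τ k) - 1‖ :=
  Summable.of_nonneg_of_le (fun _ => norm_nonneg _)
    (norm_elemFactor_div_latticePt_sub_one_le hτ le_rfl)
    ((summable_latticePt_rpow hτ (by norm_num)).mul_left _)

lemma hasProd_latticeProd {τ : ℝ} (hτ : 0 < τ) (z : ℂ) :
    HasProd (fun k => elemFactor (z / latticePt τ k)) (latticeProd τ z) := by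
  have := multipliable_one_add_of_summable (summable_norm_elemFactor_sub_one hτ z)
  simp only [add_sub_cancel] at this
  exact this.hasProd

lemma differentiable_latticeProd {τ : ℝ} (hτ : 0 < τ) : Differentiable ℂ (latticeProd τ) := by
  intro z
  have h := Summable.hasProdLocallyUniformlyOn_one_add (K := Metric.ball (0 : ℂ) (‖z‖ + 1))
    (f := fun k z => elemFactor (z / latticePt τ k) - 1) Metric.isOpen_ball
    ((summable_latticePt_rpow hτ (by norm_num)).mul_left _)
    (.of_forall fun k x hx => norm_elemFactor_div_latticePt_sub_one_le hτ
      (by simpa using (mem_ball_zero_iff.mp hx).le) k)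
    (fun k => ((differentiable_elemFactor.comp (differentiable_id.div_const _)).sub_const
      1).continuous.continuousOn)
  simp only [add_sub_cancel] at h
  refine (DifferentiableOn.differentiableAt (s := Metric.ball (0 : ℂ) (‖z‖ + 1)) ?_
    (Metric.isOpen_ball.mem_nhds (by simp)))
  refine h.differentiableOn (.of_forall fun s => ?_) Metric.isOpen_ball
  refine Differentiable.differentiableOn ?_
  simpa [Finset.prod_fn] using Differentiable.finsetProd (u := s) fun k _ =>
    differentiable_elemFactor.comp (differentiable_id.div_const (latticePt τ k : ℂ))

lemma one_add_div_latticePt_ne_zero {τ : ℝ} (hτ : 0 < τ) {z : ℂ} (hz : z ∈ slitPlane)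
    (k : ℕ × ℕ) : 1 + z / latticePt τ k ≠ 0 := by
  rcases eq_or_ne k 0 with rfl | hk
  · simp [latticePt_zero]
  have hl := latticePt_pos hτ hk
  intro h
  have h1 : z = ((-latticePt τ k : ℝ) : ℂ) := by
    have : (latticePt τ k : ℂ) ≠ 0 := by exact_mod_cast hl.ne'
    field_simp at h
    push_cast
    linear_combination h
  rw [h1, Complex.ofReal_mem_slitPlane] at hz
  linarith

lemma latticeProd_ne_zero {τ : ℝ} (hτ : 0 < τ) {z : ℂ} (hz : z ∈ slitPlane) :
    latticeProd τ z ≠ 0 := by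
  have := tprod_one_add_ne_zero_of_summable (f := fun k => elemFactor (z / latticePt τ k) - 1)
    (fun k => by
      simpa using elemFactor_ne_zero (one_add_div_latticePt_ne_zero hτ hz k))
    (summable_norm_elemFactor_sub_one hτ z)
  simpa only [add_sub_cancel, latticeProd] using this

lemma norm_latticeProd_neg_mul_I {τ : ℝ} (hτ : 0 < τ) (t : ℝ) :
    ‖latticeProd τ (-(t * I))‖ = ‖latticeProd τ (t * I)‖ := by
  rw [latticeProd, latticeProd, (hasProd_latticeProd hτ _).multipliable.norm_tprod,
    (hasProd_latticeProd hτ _).multipliable.norm_tprod]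
  congr 1 with k
  have h : (t * I / latticePt τ k : ℂ) = ((t / latticePt τ k : ℝ) : ℂ) * I := by
    push_cast; ring
  rw [neg_div, h, norm_elemFactor_neg_mul_I]

lemma norm_latticeProd_mul_I_le {τ : ℝ} (hτ : 0 < τ) (K : ℝ) :
    ∃ T : ℝ, ∀ t : ℝ, T ≤ t → ‖latticeProd τ (t * I)‖ ≤ Real.exp (-(K * t ^ 2)) := by
  obtain ⟨s, hs⟩ : ∃ s : Finset (ℕ × ℕ), 8 * K ≤ ∑ k ∈ s, 1 / latticePt τ k ^ 2 := by
    by_contra! h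
    exact not_summable_latticePt_sq hτ
      (summable_of_sum_le (fun _ => by positivity) fun s => (h s).le)
  refine ⟨∑ k ∈ s, latticePt τ k, fun t ht => ?_⟩
  have ht0 : 0 ≤ t := (Finset.sum_nonneg fun k _ => latticePt_nonneg hτ k).trans ht
  have key : ∀ k, (t * I / latticePt τ k : ℂ) = ((t / latticePt τ k : ℝ) : ℂ) * I := fun k => by
    push_cast; ring
  have hlim := (hasProd_latticeProd hτ (t * I)).norm
  refine le_of_tendsto hlim ?_
  filter_upwards [eventually_ge_atTop s] with S hS
  calc ∏ k ∈ S, ‖elemFactor (t * I / latticePt τ k)‖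
      ≤ ∏ k ∈ s, ‖elemFactor (t * I / latticePt τ k)‖ := by
        rw [← Finset.prod_sdiff hS]
        refine mul_le_of_le_one_left (Finset.prod_nonneg fun _ _ => norm_nonneg _)
          (Finset.prod_le_one (fun _ _ => norm_nonneg _) fun k _ => ?_)
        rw [key]
        exact norm_elemFactor_mul_I_le_one _
    _ ≤ ∏ k ∈ s, Real.exp (-((t / latticePt τ k) ^ 2 / 8)) := by
        refine Finset.prod_le_prod (fun _ _ => norm_nonneg _) fun k hk => ?_
        rw [key]
        rcases eq_or_ne k 0 with rfl | hk0
        · simp [latticePt_zero, elemFactor]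
        refine norm_elemFactor_mul_I_le ?_
        have hl := latticePt_pos hτ hk0
        have : latticePt τ k ≤ t :=
          (Finset.single_le_sum (fun k _ => latticePt_nonneg hτ k) hk).trans ht
        exact one_le_pow₀ ((one_le_div hl).mpr this)
    _ = Real.exp (-(t ^ 2 / 8 * ∑ k ∈ s, 1 / latticePt τ k ^ 2)) := by
        rw [← Real.exp_sum, Finset.mul_sum, ← Finset.sum_neg_distrib]
        congr 2 with k
        rw [div_pow]; ring
    _ ≤ _ := by
        refine Real.exp_le_exp.mpr (neg_le_neg ?_)
        nlinarith [sq_nonneg t]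

/-! ### Comparison along segments -/

lemma norm_le_exp_mul_of_norm_deriv_le {f f' : ℂ → ℂ} {z w : ℂ} {K : ℝ}
    (hf : ∀ v, HasDerivAt f (f' v) v) (hK : ∀ v ∈ segment ℝ z w, ‖f' v‖ ≤ K * ‖f v‖) :
    ‖f w‖ ≤ Real.exp (K * ‖w - z‖) * ‖f z‖ := by
  have hd : ∀ s : ℝ, HasDerivAt (fun s : ℝ => f (AffineMap.lineMap z w s))
      ((w - z) * f' (AffineMap.lineMap z w s)) s := fun s => by
    have := (hf (AffineMap.lineMap z w s)).scomp s
      (AffineMap.hasDerivAt_lineMap (𝕜 := ℝ) (a := z) (b := w) (x := s))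
    simpa [Function.comp_def] using this
  have := norm_le_gronwallBound_of_norm_deriv_right_le (a := 0) (b := 1) (δ := ‖f z‖)
    (K := K * ‖w - z‖) (ε := 0)
    (f := fun s : ℝ => f (AffineMap.lineMap z w s))
    (fun s _ => (hd s).continuousAt.continuousWithinAt)
    (fun s _ => (hd s).hasDerivWithinAt) (by simp) (fun s hs => ?_) 1 (by simp)
  · rw [gronwallBound_ε0] at this
    simpa [mul_comm] using this
  · have hmem : AffineMap.lineMap z w s ∈ segment ℝ z w := by
      rw [segment_eq_image_lineMap]
      exact ⟨s, ⟨hs.1, hs.2.le⟩, rfl⟩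
    rw [norm_mul, add_zero]
    calc _ ≤ ‖w - z‖ * (K * ‖f (AffineMap.lineMap z w s)‖) := by gcongr; exact hK _ hmem
      _ = _ := by ring

lemma norm_le_of_abs_re_le {X : ℝ} {z : ℂ} (hX : |z.re| ≤ X) (h1 : 1 ≤ |z.im|) :
    ‖z‖ ≤ (1 + X) * |z.im| := by
  have := Complex.norm_le_abs_re_add_abs_im z
  nlinarith [(abs_nonneg _).trans hX]

lemma sqrt_mul_sqrt_le_norm_add {X l : ℝ} (hl : 0 ≤ l) {z : ℂ} (hX : |z.re| ≤ X)
    (h1 : 1 ≤ |z.im|) : √|z.im| * √l ≤ (1 + X) * ‖(l : ℂ) + z‖ := by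
  have hX0 : 0 ≤ X := (abs_nonneg _).trans hX
  have ha : |z.im| ≤ ‖(l : ℂ) + z‖ := by simpa using Complex.abs_im_le_norm ((l : ℂ) + z)
  have hb : l ≤ (1 + X) * ‖(l : ℂ) + z‖ := by
    have h2 : |l + z.re| ≤ ‖(l : ℂ) + z‖ := by simpa using Complex.abs_re_le_norm ((l : ℂ) + z)
    have h3 := le_abs_self (l + z.re)
    have h4 := neg_abs_le z.re
    nlinarith
  rw [← Real.sqrt_mul (abs_nonneg _)]
  refine Real.sqrt_le_iff.mpr ⟨by positivity, ?_⟩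
  calc |z.im| * l ≤ ‖(l : ℂ) + z‖ * ((1 + X) * ‖(l : ℂ) + z‖) := by gcongr
    _ ≤ _ := by nlinarith [mul_nonneg hX0 (sq_nonneg ‖(l : ℂ) + z‖), sq_nonneg X,
                  mul_nonneg (sq_nonneg X) (sq_nonneg ‖(l : ℂ) + z‖)]

lemma norm_elemFactor_div_le {τ : ℝ} (hτ : 0 < τ) {X U : ℝ} {z w : ℂ}
    (h : ∀ v ∈ segment ℝ z w, |v.re| ≤ X ∧ 1 ≤ |v.im| ∧ |v.im| ≤ U) (k : ℕ × ℕ) :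
    ‖elemFactor (w / latticePt τ k)‖ ≤
      Real.exp ((1 + X) ^ 3 * U ^ (3 / 2 : ℝ) * latticePt τ k ^ (-(5 / 2) : ℝ) * ‖w - z‖) *
        ‖elemFactor (z / latticePt τ k)‖ := by
  rcases eq_or_ne k 0 with rfl | hk
  · have : (0 : ℝ) ^ (-(5 / 2) : ℝ) = 0 := Real.zero_rpow (by norm_num)
    simp [latticePt_zero, elemFactor, this]
  have hl := latticePt_pos hτ hk
  set l := latticePt τ k
  have hl' : (l : ℂ) ≠ 0 := by exact_mod_cast hl.ne'
  refine norm_le_exp_mul_of_norm_deriv_le (f := fun v => elemFactor (v / l))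
    (f' := fun v => (v / l) ^ 2 * Complex.exp (-(v / l) + (v / l) ^ 2 / 2) * (1 / l))
    (fun v => HasDerivAt.comp (h₂ := elemFactor) (h := fun v : ℂ => v / l) v
      (hasDerivAt_elemFactor _) ((hasDerivAt_id' v).div_const _))
    fun v hv => ?_
  obtain ⟨h1, h2, h3⟩ := h v hv
  have hX0 : 0 ≤ X := (abs_nonneg _).trans h1
  have hU0 : 0 ≤ U := (abs_nonneg _).trans h3
  have hy0 : 0 < |v.im| := one_pos.trans_le h2
  have key : ‖v‖ ^ 2 / l ^ 2 ≤
      (1 + X) ^ 3 * U ^ (3 / 2 : ℝ) * l ^ (-(5 / 2) : ℝ) * ‖(l : ℂ) + v‖ := by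
    have e1 : l ^ (-(5 / 2) : ℝ) * √l = (l ^ 2)⁻¹ := by
      rw [Real.sqrt_eq_rpow, ← Real.rpow_add hl, show (-(5 / 2) + 1 / 2 : ℝ) = -(2 : ℕ) by norm_num,
        Real.rpow_neg hl.le, Real.rpow_natCast]
    have e2 : |v.im| ^ (3 / 2 : ℝ) * √|v.im| = |v.im| ^ 2 := by
      rw [Real.sqrt_eq_rpow, ← Real.rpow_add hy0, show (3 / 2 + 1 / 2 : ℝ) = (2 : ℕ) by norm_num,
        Real.rpow_natCast]
    calc ‖v‖ ^ 2 / l ^ 2 ≤ ((1 + X) * |v.im|) ^ 2 / l ^ 2 := by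
          gcongr; exact norm_le_of_abs_re_le h1 h2
      _ = (1 + X) ^ 2 * (|v.im| ^ (3 / 2 : ℝ) * √|v.im|) * (l ^ (-(5 / 2) : ℝ) * √l) := by
          rw [e1, e2]; ring
      _ = (1 + X) ^ 2 * |v.im| ^ (3 / 2 : ℝ) * l ^ (-(5 / 2) : ℝ) * (√|v.im| * √l) := by ring
      _ ≤ (1 + X) ^ 2 * U ^ (3 / 2 : ℝ) * l ^ (-(5 / 2) : ℝ) *
            ((1 + X) * ‖(l : ℂ) + v‖) := by
          refine mul_le_mul ?_ (sqrt_mul_sqrt_le_norm_add hl.le h1 h2) (by positivity)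
            (by positivity)
          gcongr
      _ = _ := by ring
  have e : ‖1 + v / l‖ = ‖(l : ℂ) + v‖ / l := by
    rw [show (1 + v / l : ℂ) = (l + v) / l by field_simp, norm_div, Complex.norm_real,
      Real.norm_of_nonneg hl.le]
  simp only [elemFactor, norm_mul, norm_div, norm_pow, e, Complex.norm_real,
    Real.norm_of_nonneg hl.le, norm_one]
  calc _ = ‖v‖ ^ 2 / l ^ 2 * (‖Complex.exp (-(v / l) + (v / l) ^ 2 / 2)‖ / l) := by
        rw [div_pow]; ring
    _ ≤ _ := mul_le_mul_of_nonneg_right key (by positivity)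
    _ = _ := by ring

lemma norm_latticeProd_le {τ : ℝ} (hτ : 0 < τ) {X U : ℝ} {z w : ℂ}
    (h : ∀ v ∈ segment ℝ z w, |v.re| ≤ X ∧ 1 ≤ |v.im| ∧ |v.im| ≤ U) :
    ‖latticeProd τ w‖ ≤
      Real.exp ((1 + X) ^ 3 * U ^ (3 / 2 : ℝ) * (∑' k, latticePt τ k ^ (-(5 / 2) : ℝ)) * ‖w - z‖) *
        ‖latticeProd τ z‖ := by
  obtain ⟨h1, h2, h3⟩ := h z (left_mem_segment ℝ z w)
  have hX0 : 0 ≤ X := (abs_nonneg _).trans h1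
  have hU0 : 0 ≤ U := (abs_nonneg _).trans h3
  refine le_of_tendsto_of_tendsto' (hasProd_latticeProd hτ w).norm
    ((hasProd_latticeProd hτ z).norm.const_mul _) fun s => ?_
  calc _ ≤ ∏ k ∈ s, (Real.exp ((1 + X) ^ 3 * U ^ (3 / 2 : ℝ) * latticePt τ k ^ (-(5 / 2) : ℝ) *
          ‖w - z‖) * ‖elemFactor (z / latticePt τ k)‖) :=
        Finset.prod_le_prod (fun _ _ => norm_nonneg _) fun k _ => norm_elemFactor_div_le hτ h k
    _ = Real.exp ((1 + X) ^ 3 * U ^ (3 / 2 : ℝ) * (∑ k ∈ s, latticePt τ k ^ (-(5 / 2) : ℝ)) *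
          ‖w - z‖) * ∏ k ∈ s, ‖elemFactor (z / latticePt τ k)‖ := by
        rw [Finset.prod_mul_distrib, ← Real.exp_sum, Finset.mul_sum, Finset.sum_mul]
    _ ≤ _ := by
        gcongr
        exact (summable_latticePt_rpow hτ (by norm_num)).sum_le_tsum _
          fun k _ => Real.rpow_nonneg (latticePt_nonneg hτ k) _

/-! ### The Barnes double gamma function -/

lemma exists_barnesG_eq (τ : ℝ) :
    ∃ A B : ℂ, ∀ z, barnesG z τ = z / τ * Complex.exp (A * z + B * z ^ 2) * latticeProd τ z := by
  refine ⟨aBarnes τ / τ, bBarnes τ / (2 * τ), fun z => ?_⟩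
  rw [barnesG, latticeProd]
  congr 1
  · congr 2; ring
  · refine tprod_congr fun k => ?_
    split_ifs with hk
    · rw [hk]; simp [latticePt, elemFactor]
    · simp only [elemFactor, latticePt]
      push_cast
      congr 2
      rw [div_pow, div_div, mul_comm (2 : ℂ)]

lemma differentiable_barnesG {τ : ℝ} (hτ : 0 < τ) : Differentiable ℂ fun z => barnesG z τ := by
  obtain ⟨A, B, h⟩ := exists_barnesG_eq τ
  simp only [h]
  have := differentiable_latticeProd hτ
  fun_prop

lemma barnesG_ne_zero {τ : ℝ} (hτ : 0 < τ) {z : ℂ} (hz : z ∈ slitPlane) : barnesG z τ ≠ 0 := by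
  obtain ⟨A, B, h⟩ := exists_barnesG_eq τ
  rw [h]
  have : (τ : ℂ) ≠ 0 := by exact_mod_cast hτ.ne'
  exact mul_ne_zero (mul_ne_zero (div_ne_zero (slitPlane_ne_zero hz) this)
    (Complex.exp_ne_zero _)) (latticeProd_ne_zero hτ hz)

lemma mem_slitPlane_of_one_le_abs_im {z : ℂ} (hz : 1 ≤ |z.im|) : z ∈ slitPlane := by
  refine mem_slitPlane_iff.mpr (Or.inr fun h => ?_)
  norm_num [h] at hz

lemma exists_norm_barnesG_le {τ : ℝ} (hτ : 0 < τ) (X : ℝ) :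
    ∃ C, ∀ (U : ℝ) (z w : ℂ), (∀ v ∈ segment ℝ z w, |v.re| ≤ X ∧ 1 ≤ |v.im| ∧ |v.im| ≤ U) →
      ‖barnesG w τ‖ ≤ Real.exp (C * U ^ (3 / 2 : ℝ) * ‖w - z‖) * ‖barnesG z τ‖ := by
  obtain ⟨A, B, hG⟩ := exists_barnesG_eq τ
  refine ⟨1 + (‖A‖ + 2 * ‖B‖ * (1 + X)) +
    (1 + X) ^ 3 * ∑' k, latticePt τ k ^ (-(5 / 2) : ℝ), fun U z w h => ?_⟩
  obtain ⟨h1, h2, h3⟩ := h z (left_mem_segment ℝ z w)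
  have hX0 : 0 ≤ X := (abs_nonneg _).trans h1
  have hU1 : 1 ≤ U := h2.trans h3
  have hU : U ≤ U ^ (3 / 2 : ℝ) := Real.self_le_rpow_of_one_le hU1 (by norm_num)
  have hU' : 1 ≤ U ^ (3 / 2 : ℝ) := hU1.trans hU
  have hlin : ‖w‖ ≤ Real.exp (U ^ (3 / 2 : ℝ) * ‖w - z‖) * ‖z‖ := by
    refine norm_le_exp_mul_of_norm_deriv_le (f := fun v => v) (fun v => hasDerivAt_id' v)
      fun v hv => ?_
    have := (h v hv).2.1.trans (Complex.abs_im_le_norm v)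
    rw [norm_one]
    exact one_le_mul_of_one_le_of_one_le hU' this
  have hexp : ‖Complex.exp (A * w + B * w ^ 2)‖ ≤
      Real.exp ((‖A‖ + 2 * ‖B‖ * (1 + X)) * U ^ (3 / 2 : ℝ) * ‖w - z‖) *
        ‖Complex.exp (A * z + B * z ^ 2)‖ := by
    refine norm_le_exp_mul_of_norm_deriv_le (f := fun v => Complex.exp (A * v + B * v ^ 2))
      (f' := fun v => Complex.exp (A * v + B * v ^ 2) * (A + 2 * B * v))
      (fun v => ((((hasDerivAt_id' v).const_mul A).add
        (((hasDerivAt_id' v).pow 2).const_mul B)).cexp).congr_deriv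
          (by simp; ring)) fun v hv => ?_
    obtain ⟨g1, g2, g3⟩ := h v hv
    rw [norm_mul, mul_comm]
    gcongr
    have hv : ‖v‖ ≤ (1 + X) * U :=
      (norm_le_of_abs_re_le g1 g2).trans (by gcongr)
    calc _ ≤ ‖A‖ + 2 * ‖B‖ * ‖v‖ := by
          refine (norm_add_le _ _).trans_eq ?_
          simp
      _ ≤ ‖A‖ * U ^ (3 / 2 : ℝ) + 2 * ‖B‖ * ((1 + X) * U ^ (3 / 2 : ℝ)) := by
          gcongr
          · exact le_mul_of_one_le_right (norm_nonneg _) hU'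
          · exact hv.trans (by gcongr)
      _ = _ := by ring
  have hprod := norm_latticeProd_le hτ h
  rw [hG, hG, norm_mul, norm_mul, norm_mul, norm_mul, norm_div, norm_div]
  calc _ ≤ Real.exp (U ^ (3 / 2 : ℝ) * ‖w - z‖) * ‖z‖ / ‖(τ : ℂ)‖ *
          (Real.exp ((‖A‖ + 2 * ‖B‖ * (1 + X)) * U ^ (3 / 2 : ℝ) * ‖w - z‖) *
            ‖Complex.exp (A * z + B * z ^ 2)‖) *
          (Real.exp ((1 + X) ^ 3 * U ^ (3 / 2 : ℝ) * (∑' k, latticePt τ k ^ (-(5 / 2) : ℝ)) *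
            ‖w - z‖) * ‖latticeProd τ z‖) := by
        gcongr
    _ = Real.exp (U ^ (3 / 2 : ℝ) * ‖w - z‖ +
          (‖A‖ + 2 * ‖B‖ * (1 + X)) * U ^ (3 / 2 : ℝ) * ‖w - z‖ +
          (1 + X) ^ 3 * U ^ (3 / 2 : ℝ) * (∑' k, latticePt τ k ^ (-(5 / 2) : ℝ)) * ‖w - z‖) *
          (‖z‖ / ‖(τ : ℂ)‖ * ‖Complex.exp (A * z + B * z ^ 2)‖ * ‖latticeProd τ z‖) := by
        rw [Real.exp_add, Real.exp_add]; ring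
    _ = _ := by congr 2; ring

lemma exists_abs_log_norm_barnesG_sub_le {τ : ℝ} (hτ : 0 < τ) (X : ℝ) :
    ∃ C, ∀ (U : ℝ) (z w : ℂ), (∀ v ∈ segment ℝ z w, |v.re| ≤ X ∧ 1 ≤ |v.im| ∧ |v.im| ≤ U) →
      |Real.log ‖barnesG w τ‖ - Real.log ‖barnesG z τ‖| ≤ C * U ^ (3 / 2 : ℝ) * ‖w - z‖ := by
  obtain ⟨C, hC⟩ := exists_norm_barnesG_le hτ X
  have key : ∀ (U : ℝ) (z w : ℂ), (∀ v ∈ segment ℝ z w, |v.re| ≤ X ∧ 1 ≤ |v.im| ∧ |v.im| ≤ U) →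
      Real.log ‖barnesG w τ‖ - Real.log ‖barnesG z τ‖ ≤ C * U ^ (3 / 2 : ℝ) * ‖w - z‖ := by
    intro U z w h
    have hw : 0 < ‖barnesG w τ‖ := norm_pos_iff.mpr (barnesG_ne_zero hτ
      (mem_slitPlane_of_one_le_abs_im (h w (right_mem_segment ℝ z w)).2.1))
    have hz : 0 < ‖barnesG z τ‖ := norm_pos_iff.mpr (barnesG_ne_zero hτ
      (mem_slitPlane_of_one_le_abs_im (h z (left_mem_segment ℝ z w)).2.1))
    have := Real.log_le_log hw (hC U z w h)
    rw [Real.log_mul (Real.exp_ne_zero _) hz.ne', Real.log_exp] at this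
    linarith
  refine ⟨C, fun U z w h => abs_le.mpr ⟨?_, key U z w h⟩⟩
  have := key U w z (by rwa [segment_symm])
  rw [norm_sub_rev] at this
  linarith

lemma exists_log_norm_barnesG_mul_I_le {τ : ℝ} (hτ : 0 < τ) (K : ℝ) :
    ∃ T : ℝ, ∀ t : ℝ, T ≤ t → Real.log ‖barnesG (t * I) τ‖ ≤ -(K * t ^ 2) := by
  obtain ⟨A, B, hG⟩ := exists_barnesG_eq τ
  obtain ⟨T, hT⟩ := norm_latticeProd_mul_I_le hτ (K + 1 / τ + ‖A‖ + ‖B‖)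
  refine ⟨max T 1, fun t ht => ?_⟩
  have ht1 : 1 ≤ t := (le_max_right _ _).trans ht
  have ht2 : t ≤ t ^ 2 := by nlinarith
  have hne : barnesG (t * I) τ ≠ 0 := barnesG_ne_zero hτ
    (mem_slitPlane_of_one_le_abs_im (by simpa using ht1.trans (le_abs_self t)))
  refine (Real.log_le_iff_le_exp (norm_pos_iff.mpr hne)).mpr ?_
  have h1 : ‖(t * I / τ : ℂ)‖ ≤ Real.exp (1 / τ * t ^ 2) := by
    rw [norm_div, norm_mul, norm_I, Complex.norm_real, Complex.norm_real, Real.norm_of_nonneg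
      (by linarith), Real.norm_of_nonneg hτ.le]
    calc t * 1 / τ = 1 / τ * t := by ring
      _ ≤ 1 / τ * t ^ 2 := by gcongr
      _ ≤ _ := by linarith [Real.add_one_le_exp (1 / τ * t ^ 2)]
  have h2 : ‖Complex.exp (A * (t * I) + B * (t * I) ^ 2)‖ ≤ Real.exp ((‖A‖ + ‖B‖) * t ^ 2) := by
    rw [Complex.norm_exp]
    gcongr
    refine (Complex.re_le_norm _).trans ((norm_add_le _ _).trans ?_)
    rw [norm_mul A, norm_mul B, norm_pow, norm_mul, norm_I, Complex.norm_real, Real.norm_of_nonneg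
      (by linarith), mul_one, add_mul]
    gcongr
  rw [hG, norm_mul, norm_mul]
  calc _ ≤ Real.exp (1 / τ * t ^ 2) * Real.exp ((‖A‖ + ‖B‖) * t ^ 2) *
          Real.exp (-((K + 1 / τ + ‖A‖ + ‖B‖) * t ^ 2)) := by
        gcongr
        exact hT t ((le_max_left _ _).trans ht)
    _ = _ := by
        rw [← Real.exp_add, ← Real.exp_add]; congr 1; ring

lemma exists_abs_log_norm_barnesG_neg_sub_le {τ : ℝ} (hτ : 0 < τ) :
    ∃ C, 0 ≤ C ∧ ∀ t : ℝ, t ≠ 0 →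
      |Real.log ‖barnesG (-(t * I)) τ‖ - Real.log ‖barnesG (t * I) τ‖| ≤ C * |t| := by
  obtain ⟨A, B, hG⟩ := exists_barnesG_eq τ
  refine ⟨2 * ‖A‖, by positivity, fun t ht => ?_⟩
  have hz : ((t : ℂ) * I) ∈ slitPlane := mem_slitPlane_iff.mpr (Or.inr (by simpa using ht))
  have hne := latticeProd_ne_zero hτ hz
  have hτ' : (τ : ℂ) ≠ 0 := by exact_mod_cast hτ.ne'
  have ht' : (t * I / τ : ℂ) ≠ 0 := div_ne_zero (slitPlane_ne_zero hz) hτ'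
  rw [hG, hG, norm_mul, norm_mul, norm_mul, norm_mul, norm_latticeProd_neg_mul_I hτ, neg_div,
    norm_neg, Complex.norm_exp, Complex.norm_exp,
    Real.log_mul (by positivity) (by positivity), Real.log_mul (by positivity) (by positivity),
    Real.log_mul (by positivity) (by positivity), Real.log_mul (by positivity) (by positivity),
    Real.log_exp, Real.log_exp]
  have : (A * -(t * I) + B * (-(t * I)) ^ 2 : ℂ) =
      (A * (t * I) + B * (t * I) ^ 2) - 2 * (A * (t * I)) := by ring
  rw [this, Complex.sub_re]
  calc _ = |(2 * (A * (t * I)) : ℂ).re| := by rw [← abs_neg]; congr 1; ring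
    _ ≤ ‖(2 * (A * (t * I)) : ℂ)‖ := Complex.abs_re_le_norm _
    _ = _ := by simp; ring

/-! ### Growth in vertical strips -/

/-- The filter of pairs `(t, c)` with `|c| ≤ R` and `|t| → ∞`. -/
def stripInfty (R : ℝ) : Filter (ℝ × ℝ) := cocompact ℝ ×ˢ 𝓟 (Icc (-R) R)

/-- `log ‖f (c + it)‖ = M t + o(t²)` as `|t| → ∞`, uniformly in `|c| ≤ R`. -/
def HasLogGrowth (R : ℝ) (f : ℂ → ℂ) (M : ℝ → ℝ) : Prop :=
  (∀ᶠ p : ℝ × ℝ in stripInfty R, f (p.2 + p.1 * I) ≠ 0) ∧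
    (fun p : ℝ × ℝ => Real.log ‖f (p.2 + p.1 * I)‖ - M p.1) =o[stripInfty R]
      fun p : ℝ × ℝ => p.1 ^ 2

lemma tendsto_abs_fst_stripInfty (R : ℝ) :
    Tendsto (fun p : ℝ × ℝ => |p.1|) (stripInfty R) atTop :=
  (tendsto_norm_cocompact_atTop (E := ℝ)).comp tendsto_fst

lemma eventually_stripInfty (R T : ℝ) :
    ∀ᶠ p : ℝ × ℝ in stripInfty R, T ≤ |p.1| ∧ |p.2| ≤ R := by
  refine ((tendsto_abs_fst_stripInfty R).eventually_ge_atTop T).and ?_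
  have : ∀ᶠ c in 𝓟 (Icc (-R) R), |c| ≤ R :=
    eventually_principal.mpr fun c hc => abs_le.mpr hc
  exact tendsto_snd.eventually this

lemma isLittleO_stripInfty_of_le {R C T : ℝ} {r : ℝ} (hr : r < 2) {f : ℝ × ℝ → ℝ}
    (h : ∀ p : ℝ × ℝ, T ≤ |p.1| → |p.2| ≤ R → |f p| ≤ C * |p.1| ^ r) :
    f =o[stripInfty R] fun p : ℝ × ℝ => p.1 ^ 2 := by
  have h1 : f =O[stripInfty R] fun p : ℝ × ℝ => |p.1| ^ r := by
    refine Asymptotics.IsBigO.of_bound C ?_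
    filter_upwards [eventually_stripInfty R T] with p hp
    rw [Real.norm_eq_abs, Real.norm_of_nonneg (by positivity)]
    exact h p hp.1 hp.2
  refine h1.trans_isLittleO ?_
  have h2 : (fun x : ℝ => x ^ r) =o[atTop] fun x : ℝ => x ^ 2 := by
    refine (Asymptotics.isLittleO_iff_tendsto' ?_).mpr ?_
    · filter_upwards [eventually_gt_atTop 0] with x hx h
      exact absurd h (pow_pos hx 2).ne'
    · refine (tendsto_rpow_neg_atTop (sub_pos.mpr hr)).congr' ?_
      filter_upwards [eventually_gt_atTop 0] with x hx
      rw [neg_sub, Real.rpow_sub hx, Real.rpow_two]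
  simpa [Function.comp_def] using h2.comp_tendsto (tendsto_abs_fst_stripInfty R)

lemma HasLogGrowth.mul {R : ℝ} {f g : ℂ → ℂ} {M L : ℝ → ℝ} (hf : HasLogGrowth R f M)
    (hg : HasLogGrowth R g L) :
    HasLogGrowth R (fun s => f s * g s) (fun t => M t + L t) := by
  refine ⟨by filter_upwards [hf.1, hg.1] with p h1 h2 using mul_ne_zero h1 h2, ?_⟩
  refine (hf.2.add hg.2).congr' ?_ .rfl
  filter_upwards [hf.1, hg.1] with p h1 h2
  rw [norm_mul, Real.log_mul (norm_ne_zero_iff.mpr h1) (norm_ne_zero_iff.mpr h2)]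
  ring

lemma HasLogGrowth.inv {R : ℝ} {f : ℂ → ℂ} {M : ℝ → ℝ} (hf : HasLogGrowth R f M) :
    HasLogGrowth R (fun s => (f s)⁻¹) (fun t => -M t) := by
  refine ⟨by filter_upwards [hf.1] with p h1 using inv_ne_zero h1, ?_⟩
  refine hf.2.neg_left.congr_left fun p => ?_
  rw [norm_inv, Real.log_inv]
  ring

lemma hasLogGrowth_one (R : ℝ) : HasLogGrowth R (fun _ => 1) (fun _ => 0) :=
  ⟨by simp, by simp⟩

lemma HasLogGrowth.prod {R : ℝ} {ι : Type*} (s : Finset ι) {f : ι → ℂ → ℂ} {M : ι → ℝ → ℝ}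
    (h : ∀ i ∈ s, HasLogGrowth R (f i) (M i)) :
    HasLogGrowth R (fun z => ∏ i ∈ s, f i z) (fun t => ∑ i ∈ s, M i t) := by
  classical
  induction s using Finset.induction_on with
  | empty => simpa using hasLogGrowth_one R
  | insert i s hi ih =>
    simp only [Finset.prod_insert hi, Finset.sum_insert hi]
    exact (h i (by simp)).mul (ih fun j hj => h j (by simp [hj]))

lemma hasLogGrowth_exp_mul (R : ℝ) (β : ℂ) :
    HasLogGrowth R (fun s => Complex.exp (β * s)) (fun _ => 0) := by
  refine ⟨by simp [Complex.exp_ne_zero], ?_⟩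
  refine isLittleO_stripInfty_of_le (C := ‖β‖ * (|R| + 1)) (T := 1) (r := 1) (by norm_num)
    fun p h1 h2 => ?_
  rw [Complex.norm_exp, Real.log_exp, sub_zero, Real.rpow_one]
  refine (Complex.abs_re_le_norm _).trans ?_
  rw [norm_mul, mul_assoc]
  gcongr
  refine (norm_add_le _ _).trans ?_
  rw [norm_mul, norm_I, Complex.norm_real, Complex.norm_real, Real.norm_eq_abs, Real.norm_eq_abs]
  nlinarith [le_abs_self R, abs_nonneg R]

lemma hasLogGrowth_exp_mul_sq (R : ℝ) (β : ℂ) :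
    HasLogGrowth R (fun s => Complex.exp (β * s ^ 2)) (fun t => -(β.re * t ^ 2)) := by
  refine ⟨by simp [Complex.exp_ne_zero], ?_⟩
  refine isLittleO_stripInfty_of_le (C := |β.re| * R ^ 2 + 2 * |β.im| * |R|) (T := 1) (r := 1)
    (by norm_num) fun p h1 h2 => ?_
  have hs : (β * ((p.2 : ℂ) + p.1 * I) ^ 2).re - -(β.re * p.1 ^ 2) =
      β.re * p.2 ^ 2 - 2 * β.im * (p.2 * p.1) := by
    simp [pow_two]; ring
  rw [Complex.norm_exp, Real.log_exp, hs, Real.rpow_one]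
  have h3 : |p.2| ≤ |R| := h2.trans (le_abs_self R)
  have h4 : p.2 ^ 2 ≤ R ^ 2 := sq_le_sq.mpr h3
  calc _ ≤ |β.re| * p.2 ^ 2 * 1 + 2 * |β.im| * |p.2| * |p.1| := by
        refine (abs_sub _ _).trans_eq ?_
        simp only [abs_mul, abs_pow, sq_abs, abs_two]
        ring
    _ ≤ |β.re| * R ^ 2 * |p.1| + 2 * |β.im| * |R| * |p.1| := by gcongr
    _ = _ := by ring

lemma hasLogGrowth_barnesG {τ : ℝ} (hτ : 0 < τ) (R : ℝ) (d : ℂ) {σ : ℝ} (hσ : |σ| = 1) :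
    HasLogGrowth R (fun s => barnesG (d + σ * s) τ)
      (fun t => Real.log ‖barnesG (|t| * I) τ‖) := by
  obtain ⟨C, hC⟩ := exists_abs_log_norm_barnesG_sub_le hτ (‖d‖ + |R|)
  obtain ⟨C', hC'0, hC'⟩ := exists_abs_log_norm_barnesG_neg_sub_le hτ
  constructor
  · filter_upwards [eventually_stripInfty R (|d.im| + 1)] with p hp
    refine barnesG_ne_zero hτ (mem_slitPlane_of_one_le_abs_im ?_)
    have := abs_sub_abs_le_abs_add (σ * p.1) d.im
    rw [abs_mul, hσ, one_mul, add_comm] at this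
    simp
    linarith [hp.1]
  refine isLittleO_stripInfty_of_le (C := |C| * 2 ^ (3 / 2 : ℝ) * (‖d‖ + |R|) + C')
    (T := |d.im| + 1) (r := 3 / 2) (by norm_num) fun p h1 h2 => ?_
  obtain ⟨t, c⟩ := p
  simp only at h1 h2 ⊢
  have ht1 : 1 ≤ |t| := by linarith [abs_nonneg d.im]
  have ht0 : t ≠ 0 := by rintro rfl; norm_num at ht1
  have hc : |c| ≤ |R| := h2.trans (le_abs_self R)
  have hsub : ‖(d + σ * (c + t * I)) - σ * t * I‖ ≤ ‖d‖ + |R| := by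
    rw [show (d + σ * (c + t * I)) - σ * t * I = d + σ * c by ring]
    refine (norm_add_le _ _).trans ?_
    rw [norm_mul, Complex.norm_real, Complex.norm_real, Real.norm_eq_abs, Real.norm_eq_abs, hσ,
      one_mul]
    gcongr
  have hA := hC (2 * |t|) (σ * t * I) (d + σ * (c + t * I)) fun v hv => by
    rw [segment_eq_image'] at hv
    obtain ⟨x, hx, rfl⟩ := hv
    have hre : (σ * t * I + x • (d + σ * (c + t * I) - σ * t * I) : ℂ).re =
        x * (d + σ * c).re := by simp
    have him : (σ * t * I + x • (d + σ * (c + t * I) - σ * t * I) : ℂ).im =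
        σ * t + x * d.im := by simp
    have hxd : |x * d.im| ≤ |d.im| := by
      rw [abs_mul, abs_of_nonneg hx.1]; exact mul_le_of_le_one_left (abs_nonneg _) hx.2
    have hσt : |σ * t| = |t| := by rw [abs_mul, hσ, one_mul]
    rw [hre, him]
    refine ⟨?_, ?_, ?_⟩
    · rw [abs_mul, abs_of_nonneg hx.1]
      refine (mul_le_of_le_one_left (abs_nonneg _) hx.2).trans ((Complex.abs_re_le_norm _).trans ?_)
      rwa [show d + σ * c = d + σ * (c + t * I) - σ * t * I by ring]
    · have := abs_sub_abs_le_abs_add (σ * t) (x * d.im)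
      linarith
    · have := abs_add_le (σ * t) (x * d.im)
      linarith
  have hB : |Real.log ‖barnesG (σ * t * I) τ‖ - Real.log ‖barnesG (|t| * I) τ‖| ≤ C' * |t| := by
    have h3 : σ * t = |t| ∨ σ * t = -|t| := by
      have : |σ * t| = |t| := by rw [abs_mul, hσ, one_mul]
      rcases abs_choice (σ * t) with h | h <;> rw [h] at this
      · exact Or.inl this
      · exact Or.inr (by linarith)
    rcases h3 with h3 | h3
    · rw [← Complex.ofReal_mul, h3]
      simp; positivity
    · rw [← Complex.ofReal_mul, h3]
      have := hC' |t| (abs_ne_zero.mpr ht0)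
      rw [abs_abs] at this
      push_cast
      rwa [neg_mul]
  have ht : |t| ≤ |t| ^ (3 / 2 : ℝ) := Real.self_le_rpow_of_one_le ht1 (by norm_num)
  calc _ ≤ C * (2 * |t|) ^ (3 / 2 : ℝ) * ‖(d + σ * (c + t * I)) - σ * t * I‖ + C' * |t| :=
        (abs_sub_le _ _ _).trans (add_le_add hA hB)
    _ ≤ |C| * (2 * |t|) ^ (3 / 2 : ℝ) * (‖d‖ + |R|) + C' * |t| ^ (3 / 2 : ℝ) := by
        gcongr
        exact le_abs_self C
    _ = _ := by
        rw [Real.mul_rpow (by norm_num) (abs_nonneg _)]; ring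

/-! ### Shifting vertical contours -/

lemma integrable_verticalLine {F : ℂ → ℂ} {c δ : ℝ} (hδ : 0 < δ)
    (hF : ∀ t : ℝ, ContinuousAt F (c + t * I))
    (hb : ∀ᶠ t : ℝ in cocompact ℝ, ‖F (c + t * I)‖ ≤ Real.exp (-δ * t ^ 2)) :
    Integrable fun t : ℝ => F (c + t * I) := by
  have hcont : Continuous fun t : ℝ => F (c + t * I) := continuous_iff_continuousAt.mpr fun t =>
    (hF t).comp (f := fun t : ℝ => (c + t * I : ℂ)) (by fun_prop)
  have hO : (fun t : ℝ => F (c + t * I)) =O[cocompact ℝ] fun t : ℝ => Real.exp (-δ * t ^ 2) := by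
    refine Asymptotics.IsBigO.of_bound 1 ?_
    filter_upwards [hb] with t ht
    simpa using ht
  exact hcont.locallyIntegrable.integrable_of_isBigO_cocompact hO
    ((integrable_exp_neg_mul_sq hδ).integrableAtFilter _)

lemma integral_verticalLine_eq_of_le {F : ℂ → ℂ} {c₀ c₁ δ : ℝ} (hc : c₀ ≤ c₁) (hδ : 0 < δ)
    (hF : ∀ s : ℂ, c₀ ≤ s.re → s.re ≤ c₁ → DifferentiableAt ℂ F s)
    (hb : ∀ᶠ t : ℝ in cocompact ℝ, ∀ c ∈ Icc c₀ c₁, ‖F (c + t * I)‖ ≤ Real.exp (-δ * t ^ 2)) :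
    ∫ t : ℝ, F (c₀ + t * I) = ∫ t : ℝ, F (c₁ + t * I) := by
  have hint : ∀ c ∈ Icc c₀ c₁, Integrable fun t : ℝ => F (c + t * I) := fun c hc' =>
    integrable_verticalLine hδ
      (fun t => (hF _ (by simpa using hc'.1) (by simpa using hc'.2)).continuousAt)
      (hb.mono fun t ht => ht c hc')
  have hlim : ∀ c ∈ Icc c₀ c₁, Tendsto (fun T : ℝ => ∫ t in (-T)..T, F (c + t * I)) atTop
      (nhds (∫ t : ℝ, F (c + t * I))) := fun c hc' =>
    intervalIntegral_tendsto_integral (hint c hc') tendsto_neg_atTop_atBot tendsto_id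
  have hexp : Tendsto (fun T : ℝ => Real.exp (-δ * T ^ 2) * |c₁ - c₀|) (cocompact ℝ)
      (nhds 0) := by
    rw [← zero_mul |c₁ - c₀|]
    refine Tendsto.mul_const _ (Real.tendsto_exp_atBot.comp ?_)
    refine Tendsto.const_mul_atTop_of_neg (by linarith) ?_
    have := (tendsto_pow_atTop (α := ℝ) two_ne_zero).comp (tendsto_norm_cocompact_atTop (E := ℝ))
    simpa [Function.comp_def] using this
  have hhor : Tendsto (fun T : ℝ => ∫ x in c₀..c₁, F (x + T * I)) (cocompact ℝ) (nhds 0) := by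
    refine squeeze_zero_norm' ?_ hexp
    filter_upwards [hb] with T hT
    refine intervalIntegral.norm_integral_le_of_norm_le_const fun x hx => hT x ?_
    rw [uIoc_of_le hc] at hx
    exact ⟨hx.1.le, hx.2⟩
  have hrect : ∀ T : ℝ, (∫ x in c₀..c₁, F (x + (-T : ℝ) * I)) - (∫ x in c₀..c₁, F (x + T * I)) +
      I * (∫ t in (-T)..T, F (c₁ + t * I)) - I * (∫ t in (-T)..T, F (c₀ + t * I)) = 0 := by
    intro T
    have := integral_boundary_rect_eq_zero_of_differentiableOn F ⟨c₀, -T⟩ ⟨c₁, T⟩ fun s hs => by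
      rw [uIcc_of_le hc, Complex.mem_reProdIm] at hs
      exact (hF s hs.1.1 hs.1.2).differentiableWithinAt
    simpa using this
  have htop : atTop ≤ cocompact ℝ := by rw [cocompact_eq_atBot_atTop]; exact le_sup_right
  have hbot : atBot ≤ cocompact ℝ := by rw [cocompact_eq_atBot_atTop]; exact le_sup_left
  have hall := (((hhor.mono_left hbot).comp tendsto_neg_atTop_atBot).sub
    (hhor.mono_left htop)).add ((hlim c₁ ⟨hc, le_rfl⟩).const_mul I) |>.sub
      ((hlim c₀ ⟨le_rfl, hc⟩).const_mul I)
  have h0 := tendsto_nhds_unique hall (tendsto_const_nhds.congr fun T => (hrect T).symm)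
  rw [sub_zero, zero_add, ← mul_sub] at h0
  exact (sub_eq_zero.mp ((mul_eq_zero.mp h0).resolve_left I_ne_zero)).symm

/-! ### The integrand of the `K`-function -/

/-- The integrand of `Kfun`, as a function on the complex plane. -/
def kIntegrand (m n : ℕ) {p q : ℕ} (a : Fin p → ℂ) (b : Fin q → ℂ) (τ α w s : ℂ) : ℂ :=
  calG m n a b s τ * Complex.exp ((Real.pi : ℂ) * α / τ * s ^ 2) *
    Complex.exp (-(2 * Real.pi * w * s))

lemma Kfun_eq (m n : ℕ) {p q : ℕ} (a : Fin p → ℂ) (b : Fin q → ℂ) (τ α : ℂ) (c : ℝ) (w : ℂ) :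
    Kfun m n a b τ α c w = 1 / (2 * Real.pi * I) *
      ((∫ t : ℝ, kIntegrand m n a b τ α w (c + t * I)) * I) := by
  rw [← integral_mul_const]
  rfl

lemma calG_reflect (m n : ℕ) {p q : ℕ} (a : Fin p → ℂ) (b : Fin q → ℂ) (s τ : ℂ) :
    calG n m (fun j => 1 + τ - b j) (fun j => 1 + τ - a j) (-s) τ = calG m n a b s τ := by
  have h1 : ∀ x : ℂ, 1 + τ - x - -s = 1 + τ - x + s := fun x => by ring
  have h2 : ∀ x : ℂ, 1 + τ - (1 + τ - x) + -s = x - s := fun x => by ring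
  simp only [calG, h1, h2]
  congr 1 <;> exact mul_comm _ _

lemma kIntegrand_reflect (m n : ℕ) {p q : ℕ} (a : Fin p → ℂ) (b : Fin q → ℂ) (τ α w s : ℂ) :
    kIntegrand n m (fun j => 1 + τ - b j) (fun j => 1 + τ - a j) τ α (-w) (-s) =
      kIntegrand m n a b τ α w s := by
  rw [kIntegrand, kIntegrand, calG_reflect, neg_sq,
    mul_neg (2 * (Real.pi : ℂ)) w, neg_mul_neg]

lemma differentiableAt_kIntegrand {τ : ℝ} (hτ : 0 < τ) (m n : ℕ) {p q : ℕ} (a : Fin p → ℂ)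
    (b : Fin q → ℂ) (α w : ℂ) {s : ℂ} (hb : ∀ j : Fin q, m ≤ (j : ℕ) → (b j).re - τ - 1 < s.re)
    (ha : ∀ k : Fin p, n ≤ (k : ℕ) → s.re < (a k).re) :
    DifferentiableAt ℂ (kIntegrand m n a b τ α w) s := by
  have hG : ∀ f : ℂ → ℂ, Differentiable ℂ f →
      DifferentiableAt ℂ (fun s => barnesG (f s) τ) s := fun f hf =>
    ((differentiable_barnesG hτ).comp hf) s
  have hcalG : DifferentiableAt ℂ (fun s => calG m n a b s τ) s := by
    unfold calG
    refine DifferentiableAt.div ?_ ?_ (mul_ne_zero ?_ ?_)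
    · refine .mul (.fun_finsetProd fun j _ => ?_) (.fun_finsetProd fun j _ => ?_) <;> split_ifs
      all_goals first | exact differentiableAt_const _ | exact hG _ (by fun_prop)
    · refine .mul (.fun_finsetProd fun j _ => ?_) (.fun_finsetProd fun j _ => ?_) <;> split_ifs
      all_goals first | exact differentiableAt_const _ | exact hG _ (by fun_prop)
    · refine Finset.prod_ne_zero_iff.mpr fun j _ => ?_
      split_ifs with h
      · refine barnesG_ne_zero hτ (Complex.mem_slitPlane_iff.mpr (Or.inl ?_))
        have := hb j h
        simp
        linarith
      · exact one_ne_zero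
    · refine Finset.prod_ne_zero_iff.mpr fun k _ => ?_
      split_ifs with h
      · refine barnesG_ne_zero hτ (Complex.mem_slitPlane_iff.mpr (Or.inl ?_))
        simpa using ha k h
      · exact one_ne_zero
  unfold kIntegrand
  fun_prop

lemma hasLogGrowth_ite_barnesG {τ : ℝ} (hτ : 0 < τ) (R : ℝ) (P : Prop) [Decidable P] (d : ℂ)
    {σ : ℝ} (hσ : |σ| = 1) {g : ℂ → ℂ} (hg : ∀ s, g s = d + σ * s) :
    HasLogGrowth R (fun s => if P then barnesG (g s) τ else 1)
      (fun t => if P then Real.log ‖barnesG (|t| * I) τ‖ else 0) := by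
  split_ifs
  · simpa only [hg] using hasLogGrowth_barnesG hτ R d hσ
  · exact hasLogGrowth_one R

lemma card_filter_fin_lt {m q : ℕ} (hm : m ≤ q) :
    (Finset.univ.filter fun j : Fin q => (j : ℕ) < m).card = m := by
  rw [Fin.card_filter_val_lt, min_eq_right hm]

lemma card_filter_fin_le {m q : ℕ} (hm : m ≤ q) :
    ((Finset.univ.filter fun j : Fin q => m ≤ (j : ℕ)).card : ℝ) = q - m := by
  have h := Finset.card_filter_add_card_filter_not (s := (Finset.univ : Finset (Fin q)))
    (fun j : Fin q => (j : ℕ) < m)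
  simp only [not_lt, card_filter_fin_lt hm, Finset.card_univ, Fintype.card_fin] at h
  rw [eq_sub_iff_add_eq']
  exact_mod_cast h

lemma hasLogGrowth_calG {τ : ℝ} (hτ : 0 < τ) (R : ℝ) {m n p q : ℕ} (hm : m ≤ q) (hn : n ≤ p)
    (a : Fin p → ℂ) (b : Fin q → ℂ) :
    HasLogGrowth R (fun s => calG m n a b s τ)
      (fun t => paramN m n p q * Real.log ‖barnesG (|t| * I) τ‖) := by
  have hneg : ∀ d s : ℂ, d - s = d + ((-1 : ℝ) : ℂ) * s := fun d s => by push_cast; ring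
  have hpos : ∀ d s : ℂ, d + s = d + ((1 : ℝ) : ℂ) * s := fun d s => by push_cast; ring
  have h1 : |(1 : ℝ)| = 1 := abs_one
  have h1' : |(-1 : ℝ)| = 1 := by simp
  have key := ((HasLogGrowth.prod Finset.univ fun (j : Fin q) _ =>
      hasLogGrowth_ite_barnesG hτ R ((j : ℕ) < m) (b j) h1' (hneg _)).mul
    (HasLogGrowth.prod Finset.univ fun (j : Fin p) _ =>
      hasLogGrowth_ite_barnesG hτ R ((j : ℕ) < n) (1 + τ - a j) h1 (hpos _))).mul
    ((HasLogGrowth.prod Finset.univ fun (j : Fin q) _ =>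
      hasLogGrowth_ite_barnesG hτ R (m ≤ (j : ℕ)) (1 + τ - b j) h1 (hpos _)).mul
    (HasLogGrowth.prod Finset.univ fun (j : Fin p) _ =>
      hasLogGrowth_ite_barnesG hτ R (n ≤ (j : ℕ)) (a j) h1' (hneg _))).inv
  simp only [calG, div_eq_mul_inv]
  convert key using 2 with t
  simp only [← Finset.sum_filter, Finset.sum_const, nsmul_eq_mul, card_filter_fin_le hm,
    card_filter_fin_le hn, card_filter_fin_lt hm, card_filter_fin_lt hn, paramN]
  push_cast
  ring

lemma hasLogGrowth_kIntegrand {τ : ℝ} (hτ : 0 < τ) (R : ℝ) {m n p q : ℕ} (hm : m ≤ q)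
    (hn : n ≤ p) (a : Fin p → ℂ) (b : Fin q → ℂ) (α w : ℂ) :
    HasLogGrowth R (kIntegrand m n a b τ α w)
      (fun t => paramN m n p q * Real.log ‖barnesG (|t| * I) τ‖ -
        ((Real.pi : ℂ) * α / τ).re * t ^ 2) := by
  have key := ((hasLogGrowth_calG hτ R hm hn a b).mul
    (hasLogGrowth_exp_mul_sq R ((Real.pi : ℂ) * α / τ))).mul
    (hasLogGrowth_exp_mul R (-(2 * Real.pi * w)))
  simp only [neg_mul, add_zero, ← sub_eq_add_neg] at key
  exact key

lemma exists_eventually_norm_kIntegrand_le {τ : ℝ} (hτ : 0 < τ) (R : ℝ) {m n p q : ℕ}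
    (hm : m ≤ q) (hn : n ≤ p) (a : Fin p → ℂ) (b : Fin q → ℂ) (α w : ℂ)
    (hcase : 0 < paramN m n p q ∨ (paramN m n p q = 0 ∧ 0 < α.re)) :
    ∃ δ : ℝ, 0 < δ ∧ ∀ᶠ t : ℝ in cocompact ℝ, ∀ c ∈ Icc (-R) R,
      ‖kIntegrand m n a b τ α w (c + t * I)‖ ≤ Real.exp (-δ * t ^ 2) := by
  set β := ((Real.pi : ℂ) * α / τ).re with hβ
  obtain ⟨δ, hδ, hM⟩ : ∃ δ : ℝ, 0 < δ ∧ ∀ᶠ t : ℝ in cocompact ℝ,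
      paramN m n p q * Real.log ‖barnesG (|t| * I) τ‖ - β * t ^ 2 ≤ -(2 * δ * t ^ 2) := by
    rcases hcase with hN | ⟨hN, hα⟩
    · obtain ⟨T, hT⟩ := exists_log_norm_barnesG_mul_I_le hτ (|β| + 2)
      refine ⟨1, one_pos, ?_⟩
      filter_upwards [(tendsto_norm_cocompact_atTop (E := ℝ)).eventually_ge_atTop T] with t ht
      have h1 := hT |t| ht
      rw [sq_abs] at h1
      have h2 : (1 : ℝ) ≤ paramN m n p q := by exact_mod_cast hN
      have h3 : 0 ≤ (|β| + 2) * t ^ 2 := by positivity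
      have h4 : -|β| * t ^ 2 ≤ β * t ^ 2 := by gcongr; exact neg_abs_le β
      nlinarith
    · refine ⟨β / 2, ?_, ?_⟩
      · have : β = Real.pi * α.re / τ := by
          rw [hβ, Complex.div_ofReal_re, Complex.re_ofReal_mul]
        rw [this]
        have := Real.pi_pos
        positivity
      · refine Eventually.of_forall fun t => ?_
        rw [hN]
        simp
        linarith
  refine ⟨δ, hδ, ?_⟩
  obtain ⟨h0, ho⟩ := hasLogGrowth_kIntegrand hτ R hm hn a b α w
  have h : ∀ᶠ x : ℝ × ℝ in stripInfty R,
      ‖kIntegrand m n a b τ α w (x.2 + x.1 * I)‖ ≤ Real.exp (-δ * x.1 ^ 2) := by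
    filter_upwards [h0, ho.bound hδ, tendsto_fst.eventually hM] with x hx0 hx hxM
    rw [← Real.log_le_iff_le_exp (norm_pos_iff.mpr hx0)]
    rw [Real.norm_eq_abs, Real.norm_of_nonneg (sq_nonneg x.1)] at hx
    have := (abs_le.mp hx).2
    linarith
  exact eventually_prod_principal_iff.mp h

/-- Reflection property of the `K`-function: `K(z) = K(1/z)` with reflected parameters. -/
theorem Kfun_reflection (τ : ℝ) (hτ : 0 < τ) (α : ℂ) (m n : ℕ) {p q : ℕ}
    (hm : m ≤ q) (hn : n ≤ p) (a : Fin p → ℂ) (b : Fin q → ℂ)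
    (hsep : ∀ j : Fin q, ∀ k : Fin p, m ≤ (j : ℕ) → n ≤ (k : ℕ) →
      (b j).re - τ - 1 < (a k).re)
    (hcase : 0 < paramN m n p q ∨ (paramN m n p q = 0 ∧ 0 < α.re))
    (w : ℂ) (c c' : ℝ)
    (hc1 : ∀ j : Fin q, m ≤ (j : ℕ) → (b j).re - τ - 1 < c)
    (hc2 : ∀ k : Fin p, n ≤ (k : ℕ) → c < (a k).re)
    (hc'1 : ∀ k : Fin p, n ≤ (k : ℕ) → -(a k).re < c')
    (hc'2 : ∀ j : Fin q, m ≤ (j : ℕ) → c' < 1 + τ - (b j).re) :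
    Kfun m n a b (τ : ℂ) α c w =
      Kfun n m (fun j : Fin q => 1 + (τ : ℂ) - b j) (fun j : Fin p => 1 + (τ : ℂ) - a j)
        (τ : ℂ) α c' (-w) := by
  set F := kIntegrand m n a b (τ : ℂ) α w
  have hshift : ∀ c₀ c₁ : ℝ, c₀ ≤ c₁ → (∀ j : Fin q, m ≤ (j : ℕ) → (b j).re - τ - 1 < c₀) →
      (∀ k : Fin p, n ≤ (k : ℕ) → c₁ < (a k).re) →
      ∫ t : ℝ, F (c₀ + t * I) = ∫ t : ℝ, F (c₁ + t * I) := by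
    intro c₀ c₁ hc hb ha
    obtain ⟨δ, hδ, hF⟩ :=
      exists_eventually_norm_kIntegrand_le hτ (max |c₀| |c₁|) hm hn a b α w hcase
    refine integral_verticalLine_eq_of_le hc hδ (fun s h0 h1 => ?_) (hF.mono fun t ht x hx => ?_)
    · exact differentiableAt_kIntegrand hτ m n a b α w (fun j hj => (hb j hj).trans_le h0)
        (fun k hk => h1.trans_lt (ha k hk))
    · exact ht x (abs_le.mp (abs_le_max_abs_abs hx.1 hx.2))
  have heq : ∫ t : ℝ, F (c + t * I) = ∫ t : ℝ, F ((-c' : ℝ) + t * I) := by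
    rcases le_total c (-c') with h | h
    · exact hshift _ _ h hc1 fun k hk => by linarith [hc'1 k hk]
    · exact (hshift _ _ h (fun j hj => by linarith [hc'2 j hj]) hc2).symm
  rw [Kfun_eq, Kfun_eq, heq, ← integral_neg_eq_self]
  congr 3
  funext t
  rw [← neg_neg ((c' : ℂ) + t * I), kIntegrand_reflect]
  congr 1
  push_cast
  ring
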